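/- Let n ≥ 1 and let f : Fin n → Fin n be a function that is not bijective. Then the Frobenius norm of the deviation of the corresponding sum of basis projections from the identity satisfies ‖ Σ_{k ∈ Fin n} |e_{f(k)}⟩⟨e_{f(k)}| − Iₙ ‖₂ ≥ √2. Consequently, any classical Sudoku square violating some constraint (i.e. whose entries along some row, column, or block do not form a permutation) has SudoQ error at least √2. -/

import Mathlib

/-- The rank-one projection `|v⟩⟨v|` as a matrix. -/
noncomputable def proj {κ : Type*} [Fintype κ] (v : EuclideanSpace ℂ κ) : Matrix κ κ ℂ :=
  fun i j => v i * star (v j)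

/-- The Frobenius norm `‖A‖₂ = √(Tr(A* A))`. -/
noncomputable def frobNorm {κ : Type*} [Fintype κ] (A : Matrix κ κ ℂ) : ℝ :=
  Real.sqrt (Matrix.trace (A.conjTranspose * A)).re

/-- The standard basis of `ℂⁿ`. -/
noncomputable def E {n : ℕ} (k : Fin n) : EuclideanSpace ℂ (Fin n) :=
  EuclideanSpace.single k 1

/-- The squared Frobenius norm dominates the sum of squared moduli of the diagonal. -/
lemma sum_normSq_diag_le_trace {κ : Type*} [Fintype κ] (A : Matrix κ κ ℂ) :
    ∑ i, Complex.normSq (A i i) ≤ (Matrix.trace (A.conjTranspose * A)).re := by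
  have h : (Matrix.trace (A.conjTranspose * A)).re = ∑ i, ∑ j, Complex.normSq (A j i) := by
    simp [Matrix.trace, Matrix.mul_apply, Complex.normSq_apply]
  rw [h]
  exact Finset.sum_le_sum fun i _ =>
    Finset.single_le_sum (f := fun j => Complex.normSq (A j i))
      (fun j _ => Complex.normSq_nonneg _) (Finset.mem_univ i)

/-- The diagonal entries of `Σ_k |e_{f(k)}⟩⟨e_{f(k)}|` are the cardinalities of the fibers of `f`. -/
lemma sum_proj_E_apply_self {n : ℕ} (f : Fin n → Fin n) (i : Fin n) :
    (∑ k, proj (E (f k))) i i = ((Finset.univ.filter fun k => f k = i).card : ℂ) := by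
  rw [Matrix.sum_apply, ← Finset.sum_boole]
  refine Finset.sum_congr rfl fun k _ => ?_
  by_cases h : f k = i <;> simp [proj, E, h]

/-- If `f : Fin n → Fin n` is not bijective, then the sum of the corresponding basis
projections deviates from the identity by at least `√2` in Frobenius norm:
`‖ Σ_k |e_{f(k)}⟩⟨e_{f(k)}| − Iₙ ‖₂ ≥ √2`. Consequently, any classical Sudoku square
violating some constraint has SudoQ error at least `√2`. -/
theorem frob_dev_of_not_bijective (n : ℕ) (hn : 1 ≤ n)
    (f : Fin n → Fin n) (hf : ¬ Function.Bijective f) :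
    Real.sqrt 2 ≤ frobNorm ((∑ k : Fin n, proj (E (f k))) - 1) := by
  have hsurj : ¬ Function.Surjective f := fun h => hf (Finite.surjective_iff_bijective.mp h)
  have hinj : ¬ Function.Injective f := fun h => hf (Finite.injective_iff_bijective.mp h)
  obtain ⟨i, hi⟩ := not_forall.mp hsurj
  obtain ⟨a, b, hab, hne⟩ := Function.not_injective_iff.mp hinj
  have hij : i ≠ f a := fun h => hi ⟨a, h.symm⟩
  set c : Fin n → ℕ := fun j => (Finset.univ.filter fun k => f k = j).card with hc
  have hci : c i = 0 := by
    simpa [hc, Finset.filter_eq_empty_iff] using hi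
  have hca : (2 : ℝ) ≤ c (f a) := by
    exact_mod_cast Finset.one_lt_card.mpr ⟨a, by simp, b, by simp [hab], hne⟩
  apply Real.sqrt_le_sqrt
  refine le_trans ?_ (sum_normSq_diag_le_trace _)
  have hdiag : ∀ j, Complex.normSq (((∑ k, proj (E (f k))) - 1) j j) = ((c j : ℝ) - 1) ^ 2 := by
    intro j
    rw [Matrix.sub_apply, sum_proj_E_apply_self, Matrix.one_apply_eq]
    simp [Complex.normSq_apply, hc, sq]
  simp only [hdiag]
  calc (2 : ℝ) ≤ ((c i : ℝ) - 1) ^ 2 + ((c (f a) : ℝ) - 1) ^ 2 := by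
        rw [hci]; push_cast; nlinarith
    _ = ∑ j ∈ {i, f a}, ((c j : ℝ) - 1) ^ 2 := by rw [Finset.sum_pair hij]
    _ ≤ ∑ j, ((c j : ℝ) - 1) ^ 2 :=
        Finset.sum_le_sum_of_subset_of_nonneg (Finset.subset_univ _) fun j _ _ => sq_nonneg _
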